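/- Let u ≥ 2, i ≥ 2, and k even with 4 ≤ k ≤ 2i. Set q = ⌊u·P_{2i+1}(u)/P_k(u)⌋. Then for 0 ≤ p ≤ q, the p-genus satisfies n_p(P_{2i+1}(u), P_{2i+3}(u), P_{2i+k+1}(u)) = −p²·P_k(u)·P_{k-2}(u)/(2u²) + (p/(2u²))·P_k(u)·(2u·P_{2i+3}(u) − P_{k-2}(u)) + (1/(2u²))·(u²·(P_{2i+1}(u)−1)·(P_{2i+3}(u)−1) − q·P_{k-2}(u)·(2u·P_{2i+1}(u) − (q+1)·P_k(u))). -/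

import Mathlib

def pell (u : ℕ) : ℕ → ℕ
  | 0 => 0
  | 1 => 1
  | n + 2 => u * pell u (n + 1) + pell u n


noncomputable def reps (a b c m : ℕ) : ℕ :=
  Nat.card {t : ℕ × ℕ × ℕ // t.1 * a + t.2.1 * b + t.2.2 * c = m}

section Pell

theorem pell_add_two (u n : ℕ) : pell u (n + 2) = u * pell u (n + 1) + pell u n := rfl

theorem mul_pell_add (u n : ℕ) : ∀ e : ℕ,
    u * pell u (n + e + 2) + pell u e * pell u n = pell u (e + 2) * pell u (n + 2)
  | 0 => by simp [pell]
  | 1 => by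
    rw [show n + 1 + 2 = (n + 1) + 2 from rfl, pell_add_two u (n + 1)]
    simp only [pell]
    ring
  | e + 2 => by
    have h₀ := mul_pell_add u n e
    have h₁ := mul_pell_add u n (e + 1)
    have h₂ : pell u (n + (e + 2) + 2) = u * pell u (n + (e + 1) + 2) + pell u (n + e + 2) := rfl
    have h₃ : pell u (e + 2 + 2) = u * pell u (e + 1 + 2) + pell u (e + 2) := rfl
    rw [h₂, h₃, add_mul, ← h₀, mul_assoc u, ← h₁, pell_add_two u e]
    ring

theorem dvd_pell_two_mul (u : ℕ) : ∀ t : ℕ, u ∣ pell u (2 * t)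
  | 0 => by simp [pell]
  | t + 1 => (Nat.dvd_add_right (dvd_mul_right u _)).2 (dvd_pell_two_mul u t)

theorem coprime_pell_two_mul_add_one (u : ℕ) : ∀ i : ℕ, Nat.Coprime (pell u (2 * i + 1)) u
  | 0 => by simp [pell]
  | i + 1 => by
    rw [show 2 * (i + 1) + 1 = (2 * i + 1) + 2 by ring, pell_add_two]
    simpa using coprime_pell_two_mul_add_one u i

theorem coprime_pell_succ (u : ℕ) : ∀ n : ℕ, Nat.Coprime (pell u n) (pell u (n + 1))
  | 0 => by simp [pell]
  | n + 1 => by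
    rw [pell_add_two]
    simpa using (coprime_pell_succ u n).symm

theorem pell_pos {u : ℕ} (hu : 0 < u) : ∀ n : ℕ, 0 < pell u (n + 1)
  | 0 => by simp [pell]
  | n + 1 => by
    rw [pell_add_two]
    have := Nat.mul_pos hu (pell_pos hu n)
    omega

end Pell

theorem two_mul_sum_range_div (K n : ℕ) :
    2 * ∑ t ∈ Finset.range n, ((t / K : ℕ) : ℤ)
      = 2 * n * (n / K : ℕ) - K * (n / K : ℕ) * ((n / K : ℕ) + 1) := by
  induction n with
  | zero => simp
  | succ n ih =>
    rw [Finset.sum_range_succ, mul_add, ih, Nat.succ_div]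
    split_ifs with h
    · have h₁ : (n + 1) / K = n / K + 1 := by rw [Nat.succ_div, if_pos h]
      have h₂ : ((n : ℤ) + 1) = K * ((n / K : ℕ) + 1) := by
        have := Nat.mul_div_cancel' h
        rw [h₁] at this
        exact_mod_cast this.symm
      push_cast at h₂ ⊢
      linear_combination (-2 : ℤ) * h₂
    · push_cast
      ring

theorem two_mul_sum_range_mul_div {a b : ℕ} (ha : 0 < a) (hab : Nat.Coprime a b) :
    2 * ∑ r ∈ Finset.range a, ((r * b / a : ℕ) : ℤ) = (a - 1) * (b - 1) := by
  obtain ⟨n, rfl⟩ : ∃ n, a = n + 1 := ⟨a - 1, by omega⟩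
  rw [Finset.sum_range_succ']
  simp only [Nat.zero_mul, Nat.zero_div, Nat.cast_zero, add_zero]
  rw [two_mul]
  nth_rewrite 1 [← Finset.sum_range_reflect]
  rw [← Finset.sum_add_distrib, Finset.sum_congr rfl (g := fun _ => (b : ℤ) - 1)]
  · simp only [Finset.sum_const, Finset.card_range, nsmul_eq_mul]
    push_cast
    ring
  · intro j hj
    rw [Finset.mem_range] at hj
    have hr : n - 1 - j + 1 = n - j := by omega
    rw [hr]
    have hnd : ¬ (n + 1) ∣ (j + 1) * b := fun h => by
      have := Nat.le_of_dvd (by omega) (hab.dvd_of_dvd_mul_right h)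
      omega
    have h₁ := Nat.div_add_mod ((j + 1) * b) (n + 1)
    have h₂ := Nat.mod_lt ((j + 1) * b) (Nat.succ_pos n)
    have h₃ : 0 < (j + 1) * b % (n + 1) := Nat.pos_of_ne_zero fun h =>
      hnd (Nat.dvd_of_mod_eq_zero h)
    have h₄ : ((n - j) * b : ℕ) + (j + 1) * b = (n + 1) * b := by
      rw [← add_mul]; congr 1; omega
    have hle : (j + 1) * b / (n + 1) < b := by
      rw [Nat.div_lt_iff_lt_mul (Nat.succ_pos n)]
      have : 0 < b := Nat.pos_of_ne_zero fun h => hnd (by simp [h])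
      nlinarith
    have h₅ : (n - j) * b / (n + 1) = b - 1 - (j + 1) * b / (n + 1) := by
      obtain ⟨d, hd⟩ : ∃ d, b = (j + 1) * b / (n + 1) + 1 + d := ⟨_, (Nat.add_sub_of_le hle).symm⟩
      have hd' : b - 1 - (j + 1) * b / (n + 1) = d := by omega
      rw [hd', Nat.div_eq_iff (show 0 < n + 1 by omega)]
      generalize (j + 1) * b / (n + 1) = e at *
      generalize (j + 1) * b % (n + 1) = s at *
      generalize (n - j) * b = w at *
      have : w + (n + 1) * e + s = (n + 1) * e + (n + 1) + (n + 1) * d := by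
        rw [add_assoc, h₁, h₄, hd]; ring
      have h₆ : d * (n + 1) = (n + 1) * d := mul_comm _ _
      omega
    omega

section Reps

variable {a b c K L : ℕ}

/-- Representations of `N * a + r * b` when `c = K * b - L * a`, where `(j, z)` stands for
`(N - b * j + L * z) * a + (r + a * j - K * z) * b + z * c`. -/
def repPairs (a b K L r : ℕ) (N : ℤ) : Set (ℕ × ℕ) :=
  {w | K * w.2 ≤ r + a * w.1 ∧ (b * w.1 : ℤ) ≤ N + L * w.2}

theorem finite_reps (ha : 0 < a) (hb : 0 < b) (hc : 0 < c) (m : ℕ) :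
    {t : ℕ × ℕ × ℕ | t.1 * a + t.2.1 * b + t.2.2 * c = m}.Finite := by
  refine (Finset.finite_toSet
    (Finset.range (m + 1) ×ˢ Finset.range (m + 1) ×ˢ Finset.range (m + 1))).subset ?_
  rintro ⟨x, y, z⟩ h
  simp only [Set.mem_ofPred_eq] at h
  have h₁ := Nat.le_mul_of_pos_right x ha
  have h₂ := Nat.le_mul_of_pos_right y hb
  have h₃ := Nat.le_mul_of_pos_right z hc
  simp only [Finset.coe_product, Set.mem_prod, Finset.mem_coe, Finset.mem_range]
  omega

theorem add_mul_mod_eq (hab : Nat.Coprime a b) (hc : c + L * a = K * b) {r : ℕ} (hr : r < a)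
    {N : ℤ} {m : ℕ} (hm : (m : ℤ) = N * a + r * b) {x y z : ℕ}
    (h : x * a + y * b + z * c = m) : (y + K * z) % a = r := by
  have hcZ : (c : ℤ) + L * a = K * b := by exact_mod_cast hc
  have hZ : (x : ℤ) * a + y * b + z * c = m := by exact_mod_cast h
  have hmod : (y + K * z) * b ≡ r * b [MOD a] := by
    rw [← Int.natCast_modEq_iff, Int.modEq_iff_dvd]
    refine ⟨x - z * L - N, ?_⟩
    push_cast
    linear_combination -hZ - hm + z * hcZ
  have hmod' := Nat.ModEq.cancel_right_of_coprime hab hmod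
  rwa [Nat.ModEq, Nat.mod_eq_of_lt hr] at hmod'

theorem repPairs_eq_image (ha : 0 < a) (hab : Nat.Coprime a b) (hc : c + L * a = K * b)
    {r : ℕ} (hr : r < a) {N : ℤ} {m : ℕ} (hm : (m : ℤ) = N * a + r * b) :
    repPairs a b K L r N = (fun t : ℕ × ℕ × ℕ => ((t.2.1 + K * t.2.2) / a, t.2.2)) ''
      {t : ℕ × ℕ × ℕ | t.1 * a + t.2.1 * b + t.2.2 * c = m} := by
  have ha' : (a : ℤ) ≠ 0 := by exact_mod_cast ha.ne'
  have hcZ : (c : ℤ) + L * a = K * b := by exact_mod_cast hc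
  ext ⟨j, z⟩
  simp only [repPairs, Set.mem_ofPred_eq, Set.mem_image, Prod.exists, Prod.mk.injEq]
  constructor
  · rintro ⟨h₁, h₂⟩
    obtain ⟨y, hy⟩ := Nat.exists_eq_add_of_le h₁
    obtain ⟨x, hx⟩ := Int.eq_ofNat_of_zero_le (sub_nonneg.2 h₂)
    refine ⟨x, y, z, ?_, ?_, rfl⟩
    · have hyZ : (r : ℤ) + a * j = K * z + y := by exact_mod_cast hy
      zify
      rw [hm]
      linear_combination (-(a : ℤ)) * hx - b * hyZ + z * hcZ
    · rw [add_comm y, ← hy, Nat.add_mul_div_left _ _ ha, Nat.div_eq_of_lt hr, zero_add]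
  · rintro ⟨x, y, z', h, hj, rfl⟩
    have hZ : (x : ℤ) * a + y * b + z' * c = m := by exact_mod_cast h
    have hmod := add_mul_mod_eq hab hc hr hm h
    have hw := Nat.mod_add_div (y + K * z') a
    rw [hmod, hj] at hw
    refine ⟨by omega, ?_⟩
    have hwZ : (r : ℤ) + a * j = y + K * z' := by exact_mod_cast hw
    have hx : (N + L * z' - b * j : ℤ) = x := by
      refine mul_right_cancel₀ ha' ?_
      linear_combination -hm - hZ - b * hwZ + z' * hcZ
    have : (0 : ℤ) ≤ x := Int.natCast_nonneg x
    linarith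

end Reps

/-- The least `N` for which `N * a + r * b` has more than `p` representations. -/
def threshold (a b K L p r : ℕ) : ℤ :=
  if p ≤ r / K then L * ((p : ℤ) - (r / K : ℕ))
  else b + L * ((p : ℤ) - (r / K : ℕ) - 1 - ((r + a) / K : ℕ))

section Threshold

variable {a b K L p r : ℕ} {N : ℤ}

theorem lt_of_mem_repPairs (hLK : L ≤ K) (hr : r < a) {j z : ℕ}
    (h : (j, z) ∈ repPairs a b K L r N) : (b * j : ℤ) < N + (j + 1) * a := by
  obtain ⟨h₁, h₂⟩ := h
  have h₃ : L * z < (j + 1) * a := by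
    have := Nat.mul_le_mul_right z hLK
    simp only at h₁
    nlinarith
  zify at h₃
  simp only at h₂
  linarith

theorem lt_ncard_repPairs (hK : 0 < K) (hp : p ≤ a / K) (hLK : L ≤ K)
    (hab : 3 * a ≤ b) (hr : r < a)
    (hfin : (repPairs a b K L r N).Finite) (hN : threshold a b K L p r ≤ N) :
    p < (repPairs a b K L r N).ncard := by
  have hL : (0 : ℤ) ≤ L := Int.natCast_nonneg L
  unfold threshold at hN
  split_ifs at hN with h
  · let F : Finset (ℕ × ℕ) := {0} ×ˢ Finset.Icc (r / K - p) (r / K)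
    have hF : (F : Set (ℕ × ℕ)) ⊆ repPairs a b K L r N := by
      rintro ⟨j, z⟩ hz
      simp only [F, Finset.mem_coe, Finset.mem_product, Finset.mem_singleton,
        Finset.mem_Icc] at hz
      obtain ⟨rfl, hz₁, hz₂⟩ := hz
      rw [Nat.le_div_iff_mul_le hK, mul_comm] at hz₂
      refine ⟨by simpa using hz₂, ?_⟩
      have : (0 : ℤ) ≤ (p : ℤ) - (r / K : ℕ) + z := by omega
      have := mul_nonneg hL this
      simp only [Nat.cast_zero, mul_zero]
      linarith
    have := Set.ncard_le_ncard hF hfin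
    rw [Set.ncard_coe_finset, Finset.card_product, Finset.card_singleton, Nat.card_Icc] at this
    omega
  · have hq : a / K ≤ (r + a) / K := Nat.div_le_div_right (Nat.le_add_left a r)
    let F : Finset (ℕ × ℕ) := {0} ×ˢ Finset.range (r / K + 1) ∪
      {1} ×ˢ Finset.Icc ((r + a) / K + r / K + 1 - p) ((r + a) / K)
    have hF : (F : Set (ℕ × ℕ)) ⊆ repPairs a b K L r N := by
      rintro ⟨j, z⟩ hz
      simp only [F, Finset.mem_coe, Finset.mem_union, Finset.mem_product, Finset.mem_singleton,
        Finset.mem_Icc, Finset.mem_range] at hz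
      rcases hz with ⟨rfl, hz⟩ | ⟨rfl, hz₁, hz₂⟩
      · rw [Nat.lt_succ_iff, Nat.le_div_iff_mul_le hK, mul_comm] at hz
        refine ⟨by simpa using hz, ?_⟩
        have h₁ := (Nat.mul_le_mul_right ((r + a) / K) hLK).trans (Nat.mul_div_le (r + a) K)
        have h₂ : (0 : ℤ) ≤ (p : ℤ) - (r / K : ℕ) - 1 := by omega
        have h₃ := mul_nonneg hL h₂
        have h₄ := mul_nonneg hL (Int.natCast_nonneg z)
        zify at h₁ hab hr
        push_cast at *
        linarith
      · rw [Nat.le_div_iff_mul_le hK, mul_comm] at hz₂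
        refine ⟨by simpa using hz₂, ?_⟩
        have : (0 : ℤ) ≤ (p : ℤ) - (r / K : ℕ) - 1 - ((r + a) / K : ℕ) + z := by omega
        have := mul_nonneg hL this
        simp only [Nat.cast_one, mul_one]
        linarith
    have := Set.ncard_le_ncard hF hfin
    rw [Set.ncard_coe_finset, Finset.card_union_of_disjoint, Finset.card_product,
      Finset.card_product, Finset.card_singleton, Finset.card_singleton, Nat.card_Icc,
      Finset.card_range] at this
    · omega
    · simp [Finset.disjoint_left]

theorem ncard_repPairs_le (hK : 0 < K) (hp : p ≤ a / K) (hLK : L ≤ K)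
    (hab : 3 * a ≤ b) (hr : r < a) (hN : N < threshold a b K L p r) :
    (repPairs a b K L r N).ncard ≤ p := by
  have hL : (0 : ℤ) ≤ L := Int.natCast_nonneg L
  have habZ : (3 * a : ℤ) ≤ b := by exact_mod_cast hab
  have haZ : (0 : ℤ) < a := by exact_mod_cast (Nat.zero_le r).trans_lt hr
  have hrK := Nat.zero_le (r / K)
  unfold threshold at hN
  split_ifs at hN with h
  · let F : Finset (ℕ × ℕ) := {0} ×ˢ Finset.Ioc (r / K - p) (r / K)
    have hF : repPairs a b K L r N ⊆ F := by
      rintro ⟨j, z⟩ hz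
      have hlt := lt_of_mem_repPairs hLK hr hz
      obtain ⟨h₁, h₂⟩ := hz
      have hN₀ : N < 0 := by
        have : (p : ℤ) - (r / K : ℕ) ≤ 0 := by omega
        exact hN.trans_le (mul_nonpos_of_nonneg_of_nonpos hL this)
      have hj : j = 0 := by
        by_contra hj
        have hj : (1 : ℤ) ≤ j := by omega
        nlinarith
      subst hj
      simp only [Nat.cast_zero, mul_zero, add_zero] at h₁ h₂
      rw [mul_comm, ← Nat.le_div_iff_mul_le hK] at h₁
      have : 0 < (L : ℤ) * ((p : ℤ) - (r / K : ℕ) + z) := by linarith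
      have := pos_of_mul_pos_right this hL
      simp only [F, Finset.mem_coe, Finset.mem_product, Finset.mem_singleton,
        Finset.mem_Ioc]
      exact ⟨trivial, by omega, h₁⟩
    have := Set.ncard_le_ncard hF F.finite_toSet
    rw [Set.ncard_coe_finset, Finset.card_product, Finset.card_singleton, Nat.card_Ioc] at this
    omega
  · have hq : a / K ≤ (r + a) / K := Nat.div_le_div_right (Nat.le_add_left a r)
    let F : Finset (ℕ × ℕ) := {0} ×ˢ Finset.range (r / K + 1) ∪
      {1} ×ˢ Finset.Ioc ((r + a) / K + r / K + 1 - p) ((r + a) / K)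
    have hF : repPairs a b K L r N ⊆ F := by
      rintro ⟨j, z⟩ hz
      have hlt := lt_of_mem_repPairs hLK hr hz
      obtain ⟨h₁, h₂⟩ := hz
      have hNb : N < b := by
        have : (p : ℤ) - (r / K : ℕ) - 1 - ((r + a) / K : ℕ) ≤ 0 := by omega
        linarith [mul_nonpos_of_nonneg_of_nonpos hL this]
      have hj : j < 2 := by
        by_contra hj
        have hj : (2 : ℤ) ≤ j := by omega
        nlinarith
      simp only [F, Finset.mem_coe, Finset.mem_union, Finset.mem_product, Finset.mem_singleton,
        Finset.mem_Ioc, Finset.mem_range, Nat.lt_succ_iff]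
      interval_cases j
      · simp only [mul_zero, add_zero] at h₁
        rw [mul_comm, ← Nat.le_div_iff_mul_le hK] at h₁
        exact Or.inl ⟨rfl, h₁⟩
      · simp only [Nat.cast_one, mul_one] at h₁ h₂
        rw [mul_comm, ← Nat.le_div_iff_mul_le hK] at h₁
        have : 0 < (L : ℤ) * ((p : ℤ) - (r / K : ℕ) - 1 - ((r + a) / K : ℕ) + z) := by linarith
        have := pos_of_mul_pos_right this hL
        omega
    have := Set.ncard_le_ncard hF F.finite_toSet
    rw [Set.ncard_coe_finset, Finset.card_union_of_disjoint, Finset.card_product,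
      Finset.card_product, Finset.card_singleton, Finset.card_singleton, Nat.card_Ioc,
      Finset.card_range] at this
    · omega
    · simp [Finset.disjoint_left]

theorem reps_le_iff {c m : ℕ} (hab : Nat.Coprime a b) (hc : c + L * a = K * b) (hc₀ : 0 < c)
    (hK : 0 < K) (hp : p ≤ a / K) (hLK : L ≤ K) (hba : 3 * a ≤ b) (hr : r < a)
    (hm : (m : ℤ) = N * a + r * b) :
    reps a b c m ≤ p ↔ N < threshold a b K L p r := by
  have ha : 0 < a := (Nat.zero_le r).trans_lt hr
  have himage := repPairs_eq_image ha hab hc hr hm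
  have hfin := finite_reps ha (show 0 < b by omega) hc₀ m
  have hcard : reps a b c m = (repPairs a b K L r N).ncard := by
    rw [himage, Set.InjOn.ncard_image]
    · rfl
    · rintro ⟨x, y, z⟩ h ⟨x', y', z'⟩ h' heq
      simp only [Set.mem_ofPred_eq, Prod.mk.injEq] at h h' heq
      obtain ⟨hdiv, rfl⟩ := heq
      have h₁ := Nat.mod_add_div (y + K * z) a
      have h₂ := Nat.mod_add_div (y' + K * z) a
      rw [add_mul_mod_eq hab hc hr hm h, hdiv] at h₁
      rw [add_mul_mod_eq hab hc hr hm h'] at h₂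
      obtain rfl : y = y' := by omega
      obtain rfl : x = x' := Nat.eq_of_mul_eq_mul_right ha (by omega)
      rfl
  rw [hcard]
  refine ⟨fun h => ?_, ncard_repPairs_le hK hp hLK hba hr⟩
  by_contra! hN
  exact (lt_ncard_repPairs hK hp hLK hba hr (himage ▸ hfin.image _) hN).not_ge h

theorem neg_div_le_threshold (ha : 0 < a) (hLK : L ≤ K) (hab : 3 * a ≤ b) (hr : r < a) :
    -((r * b / a : ℕ) : ℤ) ≤ threshold a b K L p r := by
  have hL : (0 : ℤ) ≤ L := Int.natCast_nonneg L
  have hdiv : ∀ n, L * (n / K) ≤ n := fun n =>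
    (Nat.mul_le_mul_right _ hLK).trans (Nat.mul_div_le n K)
  unfold threshold
  split_ifs with h
  · have h₁ : r ≤ r * b / a := by
      rw [Nat.le_div_iff_mul_le ha]
      exact Nat.mul_le_mul_left r (by omega)
    have h₂ := (hdiv r).trans h₁
    zify at h₂
    have := mul_nonneg hL (Int.natCast_nonneg p)
    push_cast
    linarith
  · have h₁ := hdiv (r + a)
    have : (0 : ℤ) ≤ (p : ℤ) - (r / K : ℕ) - 1 := by omega
    have := mul_nonneg hL this
    zify at h₁ hr hab
    have := Int.natCast_nonneg (r * b / a)
    push_cast at *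
    linarith

theorem sum_threshold (hK : 0 < K) (hp : p ≤ a / K) :
    2 * ∑ r ∈ Finset.range a, threshold a b K L p r
      = 2 * p * K * b - p * K * L - K * L * p ^ 2 - 2 * L * a * (a / K : ℕ)
        + L * K * (a / K : ℕ) * ((a / K : ℕ) + 1) := by
  have hpK : p * K ≤ a := (Nat.mul_le_mul_right K hp).trans (Nat.div_mul_le_self a K)
  have hterm : ∀ r, threshold a b K L p r = L * p - L * (r / K : ℕ)
      + if r < p * K then (b : ℤ) - L * (1 + ((a + r) / K : ℕ)) else 0 := fun r => by
    have := Nat.div_lt_iff_lt_mul (x := r) (y := p) hK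
    rw [threshold, add_comm a r]
    split_ifs <;> first | omega | (push_cast; ring)
  have hsplit := Finset.sum_range_add (fun t => ((t / K : ℕ) : ℤ)) a (p * K)
  have hsum := two_mul_sum_range_div K (a + p * K)
  rw [hsplit, Nat.add_mul_div_right _ _ hK] at hsum
  have hfilter : (Finset.range a).filter (· < p * K) = Finset.range (p * K) := by
    ext r
    simp only [Finset.mem_filter, Finset.mem_range]
    omega
  simp only [hterm]
  rw [Finset.sum_add_distrib, Finset.sum_sub_distrib, ← Finset.mul_sum, ← Finset.mul_sum, ← Finset.sum_filter,
    hfilter, Finset.sum_sub_distrib, ← Finset.mul_sum, Finset.sum_add_distrib]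
  simp only [Finset.sum_const, Finset.card_range, nsmul_eq_mul]
  push_cast at hsum ⊢
  linear_combination (-(L : ℤ)) * hsum

theorem card_reps_le {c : ℕ} (ha : 0 < a) (hab : Nat.Coprime a b) (hc : c + L * a = K * b)
    (hc₀ : 0 < c) (hK : 0 < K) (hp : p ≤ a / K) (hLK : L ≤ K) (hba : 3 * a ≤ b) :
    2 * (Nat.card {m : ℕ | reps a b c m ≤ p} : ℤ)
      = 2 * p * K * b - p * K * L - K * L * p ^ 2 - 2 * L * a * (a / K : ℕ)
        + L * K * (a / K : ℕ) * ((a / K : ℕ) + 1) + (a - 1) * (b - 1) := by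
  have haZ : (0 : ℤ) < a := by exact_mod_cast ha
  let F : Finset (Σ _ : ℕ, ℤ) := (Finset.range a).sigma fun r =>
    Finset.Ico (-((r * b / a : ℕ) : ℤ)) (threshold a b K L p r)
  have hbij : Set.BijOn (fun w : Σ _ : ℕ, ℤ => (w.2 * a + w.1 * b).toNat) F
      {m : ℕ | reps a b c m ≤ p} := by
    have hnonneg : ∀ (r : ℕ) (N : ℤ), -((r * b / a : ℕ) : ℤ) ≤ N ↔ 0 ≤ N * a + r * b := by
      intro r N
      rw [Int.natCast_div, neg_le, Int.le_ediv_iff_mul_le haZ]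
      push_cast
      constructor <;> intro h <;> linarith
    refine ⟨?_, ?_, ?_⟩
    · rintro ⟨r, N⟩ h
      simp only [F, Finset.mem_coe, Finset.mem_sigma, Finset.mem_range, Finset.mem_Ico] at h
      obtain ⟨hr, h₁, h₂⟩ := h
      exact (reps_le_iff hab hc hc₀ hK hp hLK hba hr
        (Int.toNat_of_nonneg ((hnonneg r N).1 h₁))).2 h₂
    · rintro ⟨r, N⟩ h ⟨r', N'⟩ h' heq
      simp only [F, Finset.mem_coe, Finset.mem_sigma, Finset.mem_range, Finset.mem_Ico] at h h'
      have hZ := congrArg (Nat.cast : ℕ → ℤ) heq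
      simp only at hZ
      rw [Int.toNat_of_nonneg ((hnonneg _ _).1 h.2.1),
        Int.toNat_of_nonneg ((hnonneg _ _).1 h'.2.1)] at hZ
      have hmod : r * b ≡ r' * b [MOD a] := by
        rw [← Int.natCast_modEq_iff, Int.modEq_iff_dvd]
        refine ⟨N - N', ?_⟩
        push_cast
        linear_combination -hZ
      have hrr := Nat.ModEq.cancel_right_of_coprime hab hmod
      rw [Nat.ModEq, Nat.mod_eq_of_lt h.1, Nat.mod_eq_of_lt h'.1] at hrr
      subst hrr
      have : N = N' := mul_right_cancel₀ haZ.ne' (by linarith)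
      rw [this]
    · intro m hm
      obtain ⟨r, N, hr, hmZ⟩ : ∃ (r : ℕ) (N : ℤ), r < a ∧ (m : ℤ) = N * a + r * b := by
        have hbezout := Nat.gcd_eq_gcd_ab a b
        rw [hab.gcd_eq_one, Nat.cast_one] at hbezout
        have hmod := Int.emod_nonneg (m * Nat.gcdB a b) haZ.ne'
        have hlt := Int.emod_lt_of_pos (m * Nat.gcdB a b) haZ
        have hdiv := Int.emod_add_mul_ediv (m * Nat.gcdB a b) a
        refine ⟨((m * Nat.gcdB a b) % a).toNat,
          m * Nat.gcdA a b + b * ((m * Nat.gcdB a b) / a), by omega, ?_⟩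
        rw [Int.toNat_of_nonneg hmod]
        linear_combination (m : ℤ) * hbezout - b * hdiv
      refine ⟨⟨r, N⟩, ?_, ?_⟩
      · simp only [F, Finset.mem_coe, Finset.mem_sigma, Finset.mem_range, Finset.mem_Ico]
        exact ⟨hr, (hnonneg r N).2 (hmZ ▸ Int.natCast_nonneg m),
          (reps_le_iff hab hc hc₀ hK hp hLK hba hr hmZ).1 hm⟩
      · simp only
        rw [← hmZ, Int.toNat_natCast]
  have hcard : Nat.card {m : ℕ | reps a b c m ≤ p} = F.card := by
    rw [Nat.card_coe_set_eq, ← hbij.image_eq, hbij.injOn.ncard_image,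
      Set.ncard_coe_finset]
  rw [hcard, Finset.card_sigma, ← sum_threshold hK hp, ← two_mul_sum_range_mul_div ha hab, ← mul_add,
    ← Finset.sum_add_distrib, Nat.cast_sum]
  congr 1
  refine Finset.sum_congr rfl fun r hr => ?_
  have := neg_div_le_threshold (p := p) ha hLK hba (Finset.mem_range.1 hr)
  rw [Int.card_Ico, Int.toNat_of_nonneg (by linarith)]
  ring

end Threshold

theorem stmt_19 (u : ℕ) (hu : 2 ≤ u) (i k p : ℕ) (hi : 2 ≤ i) (hkeven : Even k)
    (hk4 : 4 ≤ k) (hk : k ≤ 2 * i)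
    (q : ℕ) (hq : q = u * pell u (2 * i + 1) / pell u k) (hp : p ≤ q) :
    (Nat.card {m : ℕ |
        reps (pell u (2 * i + 1)) (pell u (2 * i + 3)) (pell u (2 * i + k + 1)) m ≤ p} : ℚ)
      = -(p ^ 2 : ℚ) * pell u k * pell u (k - 2) / (2 * u ^ 2)
        + (p : ℚ) / (2 * u ^ 2) * pell u k * (2 * u * pell u (2 * i + 3) - pell u (k - 2))
        + 1 / (2 * u ^ 2) * ((u : ℚ) ^ 2 * (pell u (2 * i + 1) - 1) * (pell u (2 * i + 3) - 1)
            - q * pell u (k - 2) * (2 * u * pell u (2 * i + 1) - (q + 1) * pell u k)) := by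
  have hu₀ : 0 < u := by omega
  obtain ⟨t, rfl⟩ : ∃ t, k = 2 * t + 2 := by
    obtain ⟨s, rfl⟩ := hkeven
    exact ⟨s - 1, by omega⟩
  rw [show 2 * t + 2 - 2 = 2 * t by omega,
    show 2 * i + (2 * t + 2) + 1 = 2 * i + 1 + 2 * t + 2 by ring,
    show 2 * i + 3 = 2 * i + 1 + 2 by ring]
  have hrec := mul_pell_add u (2 * i + 1) (2 * t)
  have hk_eq := pell_add_two u (2 * t)
  have hb_eq := pell_add_two u (2 * i + 1)
  have ha_eq := pell_add_two u (2 * i)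
  have hcop : Nat.Coprime (pell u (2 * i + 1)) (pell u (2 * i + 1 + 2)) := by
    rw [hb_eq, Nat.coprime_add_self_right]
    exact (coprime_pell_two_mul_add_one u i).mul_right (coprime_pell_succ u _)
  have ha := pell_pos hu₀ (2 * i)
  have hc₀ := pell_pos hu₀ (2 * i + 1 + 2 * t + 1)
  have hk₀ := pell_pos hu₀ (2 * t + 1)
  obtain ⟨K, hK⟩ := dvd_pell_two_mul u (t + 1)
  obtain ⟨L, hL⟩ := dvd_pell_two_mul u t
  rw [show 2 * (t + 1) = 2 * t + 2 by ring] at hK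
  have hba : 3 * pell u (2 * i + 1) ≤ pell u (2 * i + 1 + 2) := by
    rw [hb_eq, ha_eq]
    have := Nat.mul_le_mul hu hu
    nlinarith [Nat.zero_le (u * pell u (2 * i))]
  rw [hK] at hk_eq hk₀ hrec hq ⊢
  rw [hL] at hk_eq hrec ⊢
  have hK₀ : 0 < K := Nat.pos_of_mul_pos_left hk₀
  have hLK : L ≤ K := Nat.le_of_mul_le_mul_left (hk_eq ▸ Nat.le_add_left _ _) hu₀
  rw [Nat.mul_div_mul_left _ _ hu₀] at hq
  have hc : pell u (2 * i + 1 + 2 * t + 2) + L * pell u (2 * i + 1)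
      = K * pell u (2 * i + 1 + 2) := by
    refine Nat.eq_of_mul_eq_mul_left hu₀ ?_
    linear_combination hrec
  have hmain := card_reps_le (p := p) ha hcop hc hc₀ hK₀ (hq ▸ hp) hLK hba
  rw [← hq] at hmain
  have huQ : (u : ℚ) ≠ 0 := by exact_mod_cast hu₀.ne'
  have hmainQ := congrArg (Int.cast : ℤ → ℚ) hmain
  push_cast at hmainQ ⊢
  field_simp
  linear_combination hmainQ
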